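/- For all λ > 0, μ > 0, q ≥ 0 and every natural number k, ∫₀^∞ e^{-(λs + q)} ((λs + q)^k / k!) · μ e^{-μs} ds = ρ^k (1 - ρ) · e^{(μ/λ) q} · Γ(k+1, ((λ+μ)/λ) q) / k!, where ρ = λ/(λ+μ) and Γ(a, x) = ∫_x^∞ u^{a-1} e^{-u} du is the upper incomplete gamma function. (This is the distribution of the total number of overlapping customers O(t) in the stationary M/M/∞ queue, where q = q^∞(t) is the mean queue length at time t.) -/

import Mathlib

open MeasureTheory Real

/-- The upper incomplete gamma function `Γ(a, x) = ∫_x^∞ u^(a-1) e^(-u) du`. -/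
noncomputable def upperIncGamma (a x : ℝ) : ℝ :=
  ∫ u in Set.Ioi x, u ^ (a - 1) * Real.exp (-u)

/-- Distribution of the total number of overlapping customers in the M/M/∞ queue:
`∫₀^∞ e^{-(λs+q)} (λs+q)^k/k! ⋅ μ e^{-μs} ds
  = ρ^k (1-ρ) e^{(μ/λ)q} Γ(k+1, ((λ+μ)/λ) q)/k!` with `ρ = λ/(λ+μ)`. -/
theorem overlap_number_dist_MMinf (lam mu q : ℝ) (hlam : 0 < lam) (hmu : 0 < mu)
    (hq : 0 ≤ q) (k : ℕ) :
    ∫ s in Set.Ioi (0 : ℝ),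
        Real.exp (-(lam * s + q)) * (lam * s + q) ^ k / (Nat.factorial k) *
          (mu * Real.exp (-mu * s))
      = (lam / (lam + mu)) ^ k * (1 - lam / (lam + mu)) * Real.exp ((mu / lam) * q) *
          upperIncGamma (k + 1) (((lam + mu) / lam) * q) / (Nat.factorial k) := by
  have hl : lam ≠ 0 := hlam.ne'
  have hs : 0 < lam + mu := by linarith
  unfold upperIncGamma
  set c : ℝ := (lam + mu) / lam * q with hc
  have h1 : ∫ u in Set.Ioi c, u ^ ((k : ℝ) + 1 - 1) * Real.exp (-u)
      = ∫ u in Set.Ioi (0 : ℝ), (u + c) ^ k * Real.exp (-(u + c)) := by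
    have hmp := (measurePreserving_add_right (volume : Measure ℝ) c).setIntegral_preimage_emb
      (measurableEmbedding_addRight c) (fun u : ℝ => u ^ k * Real.exp (-u)) (Set.Ioi c)
    have hpre : (fun x : ℝ => x + c) ⁻¹' Set.Ioi c = Set.Ioi 0 := by
      ext x; simp
    rw [hpre] at hmp
    rw [hmp]
    simp
  have h2 := integral_comp_mul_left_Ioi
    (fun u : ℝ => (u + c) ^ k * Real.exp (-(u + c))) 0 hs
  rw [mul_zero, smul_eq_mul] at h2
  have h3 : ∫ u in Set.Ioi (0 : ℝ), (u + c) ^ k * Real.exp (-(u + c))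
      = (lam + mu) * ∫ s in Set.Ioi (0 : ℝ),
        ((lam + mu) * s + c) ^ k * Real.exp (-((lam + mu) * s + c)) := by
    rw [h2, mul_inv_cancel_left₀ hs.ne']
  rw [h1, h3, ← mul_assoc, ← integral_const_mul, ← integral_div]
  congr 1
  ext s
  have e1 : (lam + mu) * s + c = (lam + mu) / lam * (lam * s + q) := by
    rw [hc]; field_simp
  have e2 : Real.exp (-(lam * s + q)) * Real.exp (-mu * s)
      = Real.exp (mu / lam * q) * Real.exp (-((lam + mu) * s + c)) := by
    rw [← Real.exp_add, ← Real.exp_add, hc]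
    congr 1
    field_simp
    ring
  have e3 : (lam / (lam + mu)) ^ k * ((lam + mu) * s + c) ^ k = (lam * s + q) ^ k := by
    rw [← mul_pow, e1]
    congr 1
    field_simp
  have e4 : (1 - lam / (lam + mu)) * (lam + mu) = mu := by
    field_simp
    ring
  calc _ = (Real.exp (-(lam * s + q)) * Real.exp (-mu * s)) * (lam * s + q) ^ k * mu
        / (Nat.factorial k) := by ring
    _ = (Real.exp (mu / lam * q) * Real.exp (-((lam + mu) * s + c))) *
        ((lam / (lam + mu)) ^ k * ((lam + mu) * s + c) ^ k) *
        ((1 - lam / (lam + mu)) * (lam + mu)) / (Nat.factorial k) := by rw [e2, e3, e4]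
    _ = _ := by ring
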